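/- Let G be a finite group, T a G-transfer system, and T_h a saturated hull of T (i.e. T_h is a saturated G-transfer system containing T that is contained in every saturated G-transfer system containing T). Then T_h equals the complete transfer system T_c (the relation with T_c K H iff K ≤ H) if and only if T is connected, i.e. every two subgroups of G lie in the same connected component of T. -/

import Mathlib

/-- A `G`-transfer system: a relation on subgroups of `G` satisfying the subgroup,
reflexivity, transitivity, restriction, and conjugation conditions. -/
def IsTransferSystem {G : Type*} [Group G] (T : Subgroup G → Subgroup G → Prop) : Prop :=
  (∀ K H, T K H → K ≤ H) ∧
  (∀ H, T H H) ∧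
  (∀ L K H, T L K → T K H → T L H) ∧
  (∀ K H L, T K H → T (K ⊓ L) (H ⊓ L)) ∧
  (∀ K H (g : G), T K H →
    T (Subgroup.map (MulAut.conj g).toMonoidHom K) (Subgroup.map (MulAut.conj g).toMonoidHom H))

/-- Two subgroups are in the same connected component of `T` if they are related by
the reflexive-transitive closure of the symmetrization of `T`. -/
def SameComponent {G : Type*} [Group G] (T : Subgroup G → Subgroup G → Prop)
    (A B : Subgroup G) : Prop :=
  Relation.ReflTransGen (fun X Y => T X Y ∨ T Y X) A B

/-- A transfer system is saturated if `L ≤ K ≤ H` and `T L H` imply `T K H`. -/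
def IsSaturated {G : Type*} [Group G] (T : Subgroup G → Subgroup G → Prop) : Prop :=
  ∀ L K H : Subgroup G, L ≤ K → K ≤ H → T L H → T K H

/-- `Th` is a saturated hull of `T`: a saturated transfer system containing `T`
that is contained in every saturated transfer system containing `T`. -/
def IsSaturatedHull {G : Type*} [Group G] (T Th : Subgroup G → Subgroup G → Prop) : Prop :=
  IsTransferSystem Th ∧ IsSaturated Th ∧ (∀ K H, T K H → Th K H) ∧
  ∀ T'' : Subgroup G → Subgroup G → Prop, IsTransferSystem T'' → IsSaturated T'' →
    (∀ K H, T K H → T'' K H) → (∀ K H, Th K H → T'' K H)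

/-- Two subgroups in the same component of a transfer system have a common source. -/
theorem SameComponent.exists_common_source {G : Type*} [Group G]
    {T : Subgroup G → Subgroup G → Prop} (hT : IsTransferSystem T) {A B : Subgroup G}
    (h : SameComponent T A B) : ∃ X, T X A ∧ T X B := by
  obtain ⟨hle, hrefl, htrans, hres, -⟩ := hT
  induction h with
  | refl => exact ⟨A, hrefl A, hrefl A⟩
  | @tail B C _ hBC ih =>
    obtain ⟨X, hXA, hXB⟩ := ih
    rcases hBC with hBC | hCB
    · exact ⟨X, hXA, htrans _ _ _ hXB hBC⟩
    · refine ⟨C ⊓ X, htrans _ _ _ ?_ hXA, ?_⟩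
      · simpa [inf_eq_right.mpr (hle _ _ hXB)] using hres _ _ X hCB
      · simpa [inf_comm X, inf_eq_right.mpr (hle _ _ hCB)] using hres _ _ C hXB

/-- A transfer system is connected if and only if it relates `⊥` to `⊤`. -/
theorem IsTransferSystem.connected_iff_bot_top {G : Type*} [Group G]
    {T : Subgroup G → Subgroup G → Prop} (hT : IsTransferSystem T) :
    (∀ A B : Subgroup G, SameComponent T A B) ↔ T ⊥ ⊤ := by
  constructor
  · intro h
    obtain ⟨X, hbot, htop⟩ := (h ⊥ ⊤).exists_common_source hT
    rwa [le_bot_iff.mp (hT.1 _ _ hbot)] at htop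
  · intro h A B
    have hbot (L : Subgroup G) : T ⊥ L := by simpa using hT.2.2.2.1 _ _ L h
    exact .tail (.single (.inr (hbot A))) (.inl (hbot B))

/-- The explicit saturation of `T`: `K ≤ H` and some subgroup of `K` transfers to `H`. -/
def saturation {G : Type*} [Group G] (T : Subgroup G → Subgroup G → Prop)
    (K H : Subgroup G) : Prop :=
  K ≤ H ∧ ∃ L ≤ K, T L H

theorem IsTransferSystem.saturation {G : Type*} [Group G]
    {T : Subgroup G → Subgroup G → Prop} (hT : IsTransferSystem T) :
    IsTransferSystem (saturation T) := by
  obtain ⟨hle, hrefl, htrans, hres, hconj⟩ := hT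
  refine ⟨fun _ _ h => h.1, fun H => ⟨le_rfl, H, le_rfl, hrefl H⟩, ?_, ?_, ?_⟩
  · rintro A B C ⟨hAB, L, hLA, hLB⟩ ⟨hBC, M, hMB, hMC⟩
    have hLM : T (L ⊓ M) M := by simpa [inf_eq_right.mpr hMB] using hres _ _ M hLB
    exact ⟨hAB.trans hBC, L ⊓ M, inf_le_left.trans hLA, htrans _ _ _ hLM hMC⟩
  · rintro K H L ⟨hKH, M, hMK, hMH⟩
    exact ⟨inf_le_inf_right L hKH, M ⊓ L, inf_le_inf_right L hMK, hres _ _ L hMH⟩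
  · rintro K H g ⟨hKH, M, hMK, hMH⟩
    exact ⟨Subgroup.map_mono hKH, _, Subgroup.map_mono hMK, hconj _ _ g hMH⟩

theorem isSaturated_saturation {G : Type*} [Group G] (T : Subgroup G → Subgroup G → Prop) :
    IsSaturated (saturation T) := by
  rintro L K H hLK hKH ⟨-, M, hML, hMH⟩
  exact ⟨hKH, M, hML.trans hLK, hMH⟩

/-- A saturated hull of `T` is the complete transfer system iff `T` is connected. -/
theorem hull_eq_complete_iff_connected {G : Type*} [Group G] [Finite G]
    (T Th : Subgroup G → Subgroup G → Prop) (hT : IsTransferSystem T)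
    (hTh : IsSaturatedHull T Th) :
    (Th = fun K H => K ≤ H) ↔ ∀ A B : Subgroup G, SameComponent T A B := by
  rw [hT.connected_iff_bot_top]
  obtain ⟨⟨hle, -, -, hres, -⟩, hsat, hsub, hmin⟩ := hTh
  constructor
  · rintro rfl
    obtain ⟨-, L, hL, hLtop⟩ := hmin _ hT.saturation (isSaturated_saturation T)
      (fun K H h => ⟨hT.1 K H h, K, le_rfl, h⟩) ⊥ ⊤ bot_le
    rwa [le_bot_iff.mp hL] at hLtop
  · intro h
    ext K H
    refine ⟨hle K H, fun hKH => ?_⟩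
    have hKtop : Th K ⊤ := hsat ⊥ K ⊤ bot_le le_top (hsub _ _ h)
    simpa [inf_eq_left.mpr hKH] using hres _ _ H hKtop
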